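/- Let λ = (ℓ+m, ℓ) with ℓ ∈ ℤ and m ≥ 0, let w₀ be the canonical generator of the parabolic Verma module N(λ), and set w_i = U^i·w₀ for 0 ≤ i ≤ ⌊m/2⌋ (at each application of U the parameter is the one matching the weight of its argument, so w_{i+1} is U with parameter m−2i applied to w_i). Then for all 0 ≤ i ≤ ⌊m/2⌋ − 1: P₀₋·w_{i+1} = −(i+1)(ℓ+i−1)(m−2i)(m−2i−1)·w_i. In particular, if ℓ ≥ 2, then w_i ≠ 0 for all 0 ≤ i ≤ ⌊m/2⌋. -/

import Mathlib

/- Prelude: lowest weight modules for sp(4,C) -/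

set_option linter.unusedVariables false

noncomputable section

open Complex

abbrev M4C := Matrix (Fin 4) (Fin 4) ℂ

def J4 : M4C := !![0,0,1,0; 0,0,0,1; -1,0,0,0; 0,-1,0,0]

/-- The Lie algebra `sp₄(ℂ)` of matrices `g` with `ᵀg J + J g = 0`. -/
def sp4 : Set M4C := {g | g.transpose * J4 + J4 * g = 0}

def ZM : M4C := (-I) • !![0,0,1,0; 0,0,0,0; -1,0,0,0; 0,0,0,0]
def ZM' : M4C := (-I) • !![0,0,0,0; 0,0,0,1; 0,0,0,0; 0,-1,0,0]
def NPlus : M4C := ((1:ℂ)/2) • !![0,1,0,-I; -1,0,-I,0; 0,I,0,1; I,0,-1,0]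
def NMinus : M4C := ((1:ℂ)/2) • !![0,1,0,I; -1,0,I,0; 0,-I,0,1; -I,0,-1,0]
def XPlus : M4C := ((1:ℂ)/2) • !![1,0,I,0; 0,0,0,0; I,0,-1,0; 0,0,0,0]
def XMinus : M4C := ((1:ℂ)/2) • !![1,0,-I,0; 0,0,0,0; -I,0,-1,0; 0,0,0,0]
def P1Plus : M4C := ((1:ℂ)/2) • !![0,1,0,I; 1,0,I,0; 0,I,0,-1; I,0,-1,0]
def P1Minus : M4C := ((1:ℂ)/2) • !![0,1,0,-I; 1,0,-I,0; 0,-I,0,-1; -I,0,-1,0]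
def P0Plus : M4C := ((1:ℂ)/2) • !![0,0,0,0; 0,1,0,I; 0,0,0,0; 0,I,0,-1]
def P0Minus : M4C := ((1:ℂ)/2) • !![0,0,0,0; 0,1,0,-I; 0,0,0,0; 0,-I,0,-1]

/-- The standard basis of `sp₄(ℂ)`. -/
def sp4Gens : Set M4C :=
  {ZM, ZM', NPlus, NMinus, XPlus, XMinus, P1Plus, P1Minus, P0Plus, P0Minus}

variable {V : Type} [AddCommGroup V] [Module ℂ V]

/-- `ρ` is a representation of `sp₄(ℂ)` on `V`: a linear assignment of endomorphisms
turning brackets of elements of `sp₄` into commutators. -/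
def IsRep (ρ : M4C →ₗ[ℂ] Module.End ℂ V) : Prop :=
  ∀ A ∈ sp4, ∀ B ∈ sp4, ρ (A * B - B * A) = ρ A * ρ B - ρ B * ρ A

/-- `w` generates `V` as a `U(𝔤)`-module. -/
def Generates (ρ : M4C →ₗ[ℂ] Module.End ℂ V) (w : V) : Prop :=
  ∀ v : V, v ∈ Submodule.span ℂ
    {x : V | ∃ ops : List M4C, (∀ A ∈ ops, A ∈ sp4Gens) ∧
      x = (ops.map (fun A => ρ A)).prod w}

/-- The PBW-type vector `X₊^α P₁₊^β P₀₊^γ N₋^δ · w` for `t = (α, β, γ, δ)`. -/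
def pbwVec (ρ : M4C →ₗ[ℂ] Module.End ℂ V) (w : V) (t : ℕ × ℕ × ℕ × ℕ) : V :=
  ((ρ XPlus) ^ t.1 * (ρ P1Plus) ^ t.2.1 * (ρ P0Plus) ^ t.2.2.1 * (ρ NMinus) ^ t.2.2.2) w

/-- `(V, ρ, w)` is a realization of the parabolic Verma module `N(k, ℓ)` with canonical
generator `w`: `w` is a vector of weight `(k, ℓ)` annihilated by `N₊` and by
`𝔭₋ = ⟨X₋, P₁₋, P₀₋⟩`, with `N₋^{k-ℓ+1} w = 0`, generating `V`, and the PBW vectors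
`X₊^α P₁₊^β P₀₊^γ N₋^δ w` (`α,β,γ ≥ 0`, `0 ≤ δ ≤ k-ℓ`) form a `ℂ`-basis of `V`. -/
structure IsVerma (k l : ℤ) (ρ : M4C →ₗ[ℂ] Module.End ℂ V) (w : V) : Prop where
  rep : IsRep ρ
  le : l ≤ k
  ne : w ≠ 0
  wtZ : ρ ZM w = (k : ℂ) • w
  wtZ' : ρ ZM' w = (l : ℂ) • w
  annNPlus : ρ NPlus w = 0
  annXMinus : ρ XMinus w = 0
  annP1Minus : ρ P1Minus w = 0
  annP0Minus : ρ P0Minus w = 0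
  annNMinusPow : ((ρ NMinus) ^ ((k - l).toNat + 1)) w = 0
  gen : Generates ρ w
  indep : LinearIndependent ℂ
    (fun t : {t : ℕ × ℕ × ℕ × ℕ // (t.2.2.2 : ℤ) ≤ k - l} => pbwVec ρ w t.1)
  spans : ∀ v : V, v ∈ Submodule.span ℂ
    (Set.range (fun t : {t : ℕ × ℕ × ℕ × ℕ // (t.2.2.2 : ℤ) ≤ k - l} => pbwVec ρ w t.1))

/-- A `ℂ`-subspace invariant under the action of `sp₄(ℂ)`. -/
def IsInvariantSub (ρ : M4C →ₗ[ℂ] Module.End ℂ V) (W : Submodule ℂ V) : Prop :=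
  ∀ A ∈ sp4, ∀ v ∈ W, ρ A v ∈ W

/-- Irreducibility of a representation of `sp₄(ℂ)`. -/
def IsIrreducibleRep (ρ : M4C →ₗ[ℂ] Module.End ℂ V) : Prop :=
  (∃ v : V, v ≠ 0) ∧ ∀ W : Submodule ℂ V, IsInvariantSub ρ W → W = ⊥ ∨ W = ⊤

/-- `(V, ρ, w)` is a realization of the irreducible lowest weight module `L(k, ℓ)` (the
unique irreducible quotient of `N(k, ℓ)`), with lowest weight vector `w`. -/
structure IsHWIrred (k l : ℤ) (ρ : M4C →ₗ[ℂ] Module.End ℂ V) (w : V) : Prop where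
  rep : IsRep ρ
  le : l ≤ k
  ne : w ≠ 0
  wtZ : ρ ZM w = (k : ℂ) • w
  wtZ' : ρ ZM' w = (l : ℂ) • w
  annNPlus : ρ NPlus w = 0
  annXMinus : ρ XMinus w = 0
  annP1Minus : ρ P1Minus w = 0
  annP0Minus : ρ P0Minus w = 0
  annNMinusPow : ((ρ NMinus) ^ ((k - l).toNat + 1)) w = 0
  gen : Generates ρ w
  irred : IsIrreducibleRep ρ

/-- The operator `U = m(m-1) P₀₊ + (m-1) P₁₊ N₋ + X₊ N₋²` (with parameter `m`). -/
def opU (ρ : M4C →ₗ[ℂ] Module.End ℂ V) (m : ℤ) : Module.End ℂ V :=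
  ((m * (m - 1) : ℤ) : ℂ) • ρ P0Plus + ((m - 1 : ℤ) : ℂ) • (ρ P1Plus * ρ NMinus)
    + ρ XPlus * (ρ NMinus) ^ 2

/-- The operator `L = m(m-1) X₋ - (m-1) P₁₋ N₋ + P₀₋ N₋²` (with parameter `m`). -/
def opL (ρ : M4C →ₗ[ℂ] Module.End ℂ V) (m : ℤ) : Module.End ℂ V :=
  ((m * (m - 1) : ℤ) : ℂ) • ρ XMinus - ((m - 1 : ℤ) : ℂ) • (ρ P1Minus * ρ NMinus)
    + ρ P0Minus * (ρ NMinus) ^ 2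

/-- The operator `E₊ = (m+2) P₁₊ + 2 N₋ X₊` (with parameter `m`). -/
def opEp (ρ : M4C →ₗ[ℂ] Module.End ℂ V) (m : ℤ) : Module.End ℂ V :=
  ((m + 2 : ℤ) : ℂ) • ρ P1Plus + (2 : ℂ) • (ρ NMinus * ρ XPlus)

/-- The operator `E₋ = (m+2) P₁₋ - 2 N₋ P₀₋` (with parameter `m`). -/
def opEm (ρ : M4C →ₗ[ℂ] Module.End ℂ V) (m : ℤ) : Module.End ℂ V :=
  ((m + 2 : ℤ) : ℂ) • ρ P1Minus - (2 : ℂ) • (ρ NMinus * ρ P0Minus)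

/-- The operator `D₊ = P₁₊² - 4 X₊ P₀₊`. -/
def opDp (ρ : M4C →ₗ[ℂ] Module.End ℂ V) : Module.End ℂ V :=
  (ρ P1Plus) ^ 2 - (4 : ℂ) • (ρ XPlus * ρ P0Plus)

/-- The operator `D₋ = P₁₋² - 4 X₋ P₀₋`. -/
def opDm (ρ : M4C →ₗ[ℂ] Module.End ℂ V) : Module.End ℂ V :=
  (ρ P1Minus) ^ 2 - (4 : ℂ) • (ρ XMinus * ρ P0Minus)

/-- The Casimir element `Ω₂` acting through `ρ`. -/
def casimir (ρ : M4C →ₗ[ℂ] Module.End ℂ V) : Module.End ℂ V :=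
  ((1:ℂ)/2) • (ρ ZM * ρ ZM) + ((1:ℂ)/2) • (ρ ZM' * ρ ZM')
    - ((1:ℂ)/2) • (ρ NPlus * ρ NMinus + ρ NMinus * ρ NPlus)
    + (ρ XPlus * ρ XMinus + ρ XMinus * ρ XPlus)
    + ((1:ℂ)/2) • (ρ P1Plus * ρ P1Minus + ρ P1Minus * ρ P1Plus)
    + (ρ P0Plus * ρ P0Minus + ρ P0Minus * ρ P0Plus)

/-- The space of highest weight vectors of weight `(x, y)`: vectors `v` with
`Z v = x v`, `Z′ v = y v`, `N₊ v = 0`. -/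
def hwSpace (ρ : M4C →ₗ[ℂ] Module.End ℂ V) (x y : ℤ) : Submodule ℂ V :=
  Module.End.eigenspace (ρ ZM) (x : ℂ) ⊓ Module.End.eigenspace (ρ ZM') (y : ℂ)
    ⊓ LinearMap.ker (ρ NPlus)

/-- The sequence `w_i = U^i w`, starting from a vector of weight `(ℓ+m, ℓ)`, with the
parameter of `U` updated to match the weight of its argument at each step. -/
def wseq (ρ : M4C →ₗ[ℂ] Module.End ℂ V) (w : V) (m : ℕ) : ℕ → V
  | 0 => w
  | i + 1 => opU ρ ((m : ℤ) - 2 * i) (wseq ρ w m i)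

/-- The span of the highest weight vectors whose weight `(x, y)` satisfies
`x ≡ lm + r (mod 2)`. -/
def parSpace (ρ : M4C →ₗ[ℂ] Module.End ℂ V) (lm : ℤ) (r : ℤ) : Submodule ℂ V :=
  Submodule.span ℂ {v : V | ∃ x y : ℤ, ρ ZM v = (x : ℂ) • v ∧ ρ ZM' v = (y : ℂ) • v ∧
    ρ NPlus v = 0 ∧ (x - lm) % 2 = r}

/-- The global form of the operator `E₊`, agreeing with `E₊` (with parameter `m = x - y`)
on every vector of weight `(x, y)`. -/
def opEpGlobal (ρ : M4C →ₗ[ℂ] Module.End ℂ V) : Module.End ℂ V :=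
  ρ P1Plus * (ρ ZM - ρ ZM' + 2) + (2 : ℂ) • (ρ NMinus * ρ XPlus)

theorem M4C_transpose_eq (A : M4C) : A.transpose =
    !![A 0 0, A 1 0, A 2 0, A 3 0; A 0 1, A 1 1, A 2 1, A 3 1;
      A 0 2, A 1 2, A 2 2, A 3 2; A 0 3, A 1 3, A 2 3, A 3 3] := by
  ext i j
  fin_cases i <;> fin_cases j <;> rfl

theorem sp4Gens_subset_sp4 : sp4Gens ⊆ sp4 := by
  intro A hA
  rw [sp4, Set.mem_ofPred_eq, M4C_transpose_eq]
  simp only [sp4Gens, Set.mem_insert_iff, Set.mem_singleton_iff] at hA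
  rcases hA with rfl | rfl | rfl | rfl | rfl | rfl | rfl | rfl | rfl | rfl <;>
    simp [ZM, ZM', NPlus, NMinus, XPlus, XMinus, P1Plus, P1Minus, P0Plus, P0Minus, J4,
      ← Matrix.ext_iff, Fin.forall_fin_succ, Matrix.vecHead, Matrix.vecTail]

/-- The commutation rule for two standard basis elements, applied to a vector. -/
theorem IsRep.apply_apply {ρ : M4C →ₗ[ℂ] Module.End ℂ V} (h : IsRep ρ) {A B C : M4C}
    (hA : A ∈ sp4Gens) (hB : B ∈ sp4Gens) (hC : A * B - B * A = C) (v : V) :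
    ρ A (ρ B v) = ρ B (ρ A v) + ρ C v := by
  rw [← hC, h A (sp4Gens_subset_sp4 hA) B (sp4Gens_subset_sp4 hB)]
  simp

/-- The brackets needed to move `Z`, `Z'`, `N₊`, `N₋` and `𝔭₋` to the right of `𝔭₊` and `N₋`,
as identities in a representation. -/
structure BracketRules (ρ : M4C →ₗ[ℂ] Module.End ℂ V) : Prop where
  zM_xPlus (v : V) : ρ ZM (ρ XPlus v) = ρ XPlus (ρ ZM v) + ρ ((2 : ℂ) • XPlus) v
  zM_p1Plus (v : V) : ρ ZM (ρ P1Plus v) = ρ P1Plus (ρ ZM v) + ρ P1Plus v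
  zM_p0Plus (v : V) : ρ ZM (ρ P0Plus v) = ρ P0Plus (ρ ZM v) + ρ 0 v
  zM_nMinus (v : V) : ρ ZM (ρ NMinus v) = ρ NMinus (ρ ZM v) + ρ (-NMinus) v
  zM'_xPlus (v : V) : ρ ZM' (ρ XPlus v) = ρ XPlus (ρ ZM' v) + ρ 0 v
  zM'_p1Plus (v : V) : ρ ZM' (ρ P1Plus v) = ρ P1Plus (ρ ZM' v) + ρ P1Plus v
  zM'_p0Plus (v : V) : ρ ZM' (ρ P0Plus v) = ρ P0Plus (ρ ZM' v) + ρ ((2 : ℂ) • P0Plus) v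
  zM'_nMinus (v : V) : ρ ZM' (ρ NMinus v) = ρ NMinus (ρ ZM' v) + ρ NMinus v
  nPlus_xPlus (v : V) : ρ NPlus (ρ XPlus v) = ρ XPlus (ρ NPlus v) + ρ 0 v
  nPlus_p1Plus (v : V) : ρ NPlus (ρ P1Plus v) = ρ P1Plus (ρ NPlus v) + ρ ((2 : ℂ) • XPlus) v
  nPlus_p0Plus (v : V) : ρ NPlus (ρ P0Plus v) = ρ P0Plus (ρ NPlus v) + ρ P1Plus v
  nPlus_nMinus (v : V) : ρ NPlus (ρ NMinus v) = ρ NMinus (ρ NPlus v) + ρ (-ZM + ZM') v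
  nMinus_xPlus (v : V) : ρ NMinus (ρ XPlus v) = ρ XPlus (ρ NMinus v) + ρ (-P1Plus) v
  nMinus_p1Plus (v : V) : ρ NMinus (ρ P1Plus v) = ρ P1Plus (ρ NMinus v) + ρ (-(2 : ℂ) • P0Plus) v
  nMinus_p0Plus (v : V) : ρ NMinus (ρ P0Plus v) = ρ P0Plus (ρ NMinus v) + ρ 0 v
  xMinus_xPlus (v : V) : ρ XMinus (ρ XPlus v) = ρ XPlus (ρ XMinus v) + ρ (-ZM) v
  xMinus_p1Plus (v : V) : ρ XMinus (ρ P1Plus v) = ρ P1Plus (ρ XMinus v) + ρ NMinus v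
  xMinus_p0Plus (v : V) : ρ XMinus (ρ P0Plus v) = ρ P0Plus (ρ XMinus v) + ρ 0 v
  xMinus_nMinus (v : V) : ρ XMinus (ρ NMinus v) = ρ NMinus (ρ XMinus v) + ρ 0 v
  p1Minus_xPlus (v : V) : ρ P1Minus (ρ XPlus v) = ρ XPlus (ρ P1Minus v) + ρ (-NPlus) v
  p1Minus_p1Plus (v : V) : ρ P1Minus (ρ P1Plus v) = ρ P1Plus (ρ P1Minus v) + ρ (-ZM - ZM') v
  p1Minus_p0Plus (v : V) : ρ P1Minus (ρ P0Plus v) = ρ P0Plus (ρ P1Minus v) + ρ NMinus v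
  p1Minus_nMinus (v : V) : ρ P1Minus (ρ NMinus v) = ρ NMinus (ρ P1Minus v) + ρ (-(2 : ℂ) • XMinus) v
  p0Minus_xPlus (v : V) : ρ P0Minus (ρ XPlus v) = ρ XPlus (ρ P0Minus v) + ρ 0 v
  p0Minus_p1Plus (v : V) : ρ P0Minus (ρ P1Plus v) = ρ P1Plus (ρ P0Minus v) + ρ (-NPlus) v
  p0Minus_p0Plus (v : V) : ρ P0Minus (ρ P0Plus v) = ρ P0Plus (ρ P0Minus v) + ρ (-ZM') v
  p0Minus_nMinus (v : V) : ρ P0Minus (ρ NMinus v) = ρ NMinus (ρ P0Minus v) + ρ (-P1Minus) v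

set_option maxHeartbeats 4000000 in
theorem IsRep.bracketRules {ρ : M4C →ₗ[ℂ] Module.End ℂ V} (h : IsRep ρ) : BracketRules ρ := by
  constructor <;> intro v <;> apply h.apply_apply <;> first
    | simp only [sp4Gens, Set.mem_insert_iff, Set.mem_singleton_iff, true_or, or_true]
    | simp [ZM, ZM', NPlus, NMinus, XPlus, XMinus, P1Plus, P1Minus, P0Plus, P0Minus,
        ← Matrix.ext_iff, Fin.forall_fin_succ, Matrix.vecHead, Matrix.vecTail, funext_iff]
      try ring_nf
      try norm_num

/-- The properties of `v = w_i` that are propagated by `U`: it is a highest weight vector for `𝔨` of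
weight `(y + n, y)`, and `𝔭₋` sends it into the `𝔨`-module generated by a vector `u`
(a multiple of the previous vector) with `U u = t v`. -/
structure ChainStep (ρ : M4C →ₗ[ℂ] Module.End ℂ V) (n : ℤ) (y t : ℂ) (u v : V) : Prop where
  wtZ : ρ ZM v = (y + n) • v
  wtZ' : ρ ZM' v = y • v
  annNPlus : ρ NPlus v = 0
  p0Minus : ρ P0Minus v = (((n : ℂ) + 2) * (n + 1)) • u
  p1Minus : ρ P1Minus v = (2 * ((n : ℂ) + 1)) • ρ NMinus u
  xMinus : ρ XMinus v = ρ NMinus (ρ NMinus u)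
  opU_eq : opU ρ (n + 2) u = t • v

theorem opU_apply (ρ : M4C →ₗ[ℂ] Module.End ℂ V) (n : ℤ) (v : V) :
    opU ρ n v = ((n : ℂ) * (n - 1)) • ρ P0Plus v + ((n : ℂ) - 1) • ρ P1Plus (ρ NMinus v)
      + ρ XPlus (ρ NMinus (ρ NMinus v)) := by
  simp [opU, pow_two]

theorem ChainStep.next {ρ : M4C →ₗ[ℂ] Module.End ℂ V} (r : BracketRules ρ) {n : ℤ} {y t : ℂ}
    {u v : V} (s : ChainStep ρ n y t u v) :
    ChainStep ρ (n - 2) (y + 2) (t - y + 1) ((t - y + 1) • v) (opU ρ n v) := by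
  have hU := s.opU_eq
  have hN := congrArg (ρ NMinus) hU
  have hNN := congrArg (ρ NMinus) hN
  have e : opU ρ (n - 2 + 2) ((t - y + 1) • v) = (t - y + 1) • opU ρ n v := by simp
  rw [opU_apply] at hU hN hNN
  simp only [r.nMinus_xPlus, r.nMinus_p1Plus, r.nMinus_p0Plus, map_add, map_neg, map_smul,
    map_zero, LinearMap.neg_apply, LinearMap.smul_apply, LinearMap.zero_apply, add_zero] at hU hN hNN
  refine ⟨?_, ?_, ?_, ?_, ?_, ?_, e⟩ <;> rw [opU_apply] <;>
    simp only [r.zM_xPlus, r.zM_p1Plus, r.zM_p0Plus, r.zM_nMinus, r.zM'_xPlus, r.zM'_p1Plus,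
    r.zM'_p0Plus, r.zM'_nMinus, r.nPlus_xPlus, r.nPlus_p1Plus, r.nPlus_p0Plus, r.nPlus_nMinus,
    r.xMinus_xPlus, r.xMinus_p1Plus, r.xMinus_p0Plus, r.xMinus_nMinus, r.p1Minus_xPlus,
    r.p1Minus_p1Plus, r.p1Minus_p0Plus, r.p1Minus_nMinus, r.p0Minus_xPlus, r.p0Minus_p1Plus,
    r.p0Minus_p0Plus, r.p0Minus_nMinus, s.wtZ, s.wtZ', s.annNPlus, s.p0Minus, s.p1Minus, s.xMinus,
      map_add, map_sub, map_neg, map_smul, map_zero,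
      LinearMap.add_apply, LinearMap.neg_apply, LinearMap.smul_apply, LinearMap.zero_apply,
      LinearMap.sub_apply, smul_zero, add_zero, smul_add, smul_neg] <;>
    push_cast at *
  · module
  · module
  · module
  · linear_combination (norm := module) ((n : ℂ) * (n - 1)) • hU
  · linear_combination (norm := module) (2 * ((n : ℂ) - 1)) • hN
  · linear_combination (norm := module) hNN

theorem IsVerma.chainStep {l : ℤ} {m : ℕ} {ρ : M4C →ₗ[ℂ] Module.End ℂ V} {w : V}
    (h : IsVerma (l + m) l ρ w) (i : ℕ) :
    ∃ u, ChainStep ρ (m - 2 * i) (l + 2 * i) (-(i * (l + i - 2))) u (wseq ρ w m i) ∧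
      ∀ j, i = j + 1 → u = (-((j + 1) * (l + j - 1)) : ℂ) • wseq ρ w m j := by
  induction i with
  | zero =>
    refine ⟨0, ⟨?_, ?_, ?_, ?_, ?_, ?_, ?_⟩, by simp⟩ <;>
      simp [wseq, h.wtZ, h.wtZ', h.annNPlus, h.annXMinus, h.annP1Minus, h.annP0Minus]
  | succ i ih =>
    obtain ⟨u, hu, -⟩ := ih
    have := hu.next h.rep.bracketRules
    refine ⟨(-((i + 1) * (l + i - 1)) : ℂ) • wseq ρ w m i, ?_, fun j hj => ?_⟩
    rotate_left
    · obtain rfl : i = j := by omega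
      rfl
    convert this using 1
    · push_cast; ring
    · push_cast; ring
    · push_cast; ring
    · congr 1; ring
    · rfl

/-- For the parabolic Verma module `N(ℓ+m, ℓ)` with canonical generator `w₀` and
`w_i = U^i w₀` (parameters updated at each step),
`P₀₋ w_{i+1} = -(i+1)(ℓ+i-1)(m-2i)(m-2i-1) w_i` for `0 ≤ i ≤ ⌊m/2⌋ - 1`; in particular, if
`ℓ ≥ 2` then `w_i ≠ 0` for all `0 ≤ i ≤ ⌊m/2⌋`. -/
theorem statement17 (l : ℤ) (m : ℕ)
    (V : Type) [AddCommGroup V] [Module ℂ V]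
    (ρ : M4C →ₗ[ℂ] Module.End ℂ V) (w : V) (h : IsVerma (l + m) l ρ w) :
    (∀ i : ℕ, i + 1 ≤ m / 2 →
      ρ P0Minus (wseq ρ w m (i + 1)) =
        (-(((i : ℂ) + 1) * ((l : ℂ) + (i : ℂ) - 1) * ((m : ℂ) - 2 * (i : ℂ))
            * ((m : ℂ) - 2 * (i : ℂ) - 1))) • wseq ρ w m i) ∧
    (2 ≤ l → ∀ i ≤ m / 2, wseq ρ w m i ≠ 0) := by
  have key : ∀ i : ℕ, i + 1 ≤ m / 2 →
      ρ P0Minus (wseq ρ w m (i + 1)) =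
        (-(((i : ℂ) + 1) * ((l : ℂ) + (i : ℂ) - 1) * ((m : ℂ) - 2 * (i : ℂ))
            * ((m : ℂ) - 2 * (i : ℂ) - 1))) • wseq ρ w m i := by
    intro i _
    obtain ⟨u, hu, hj⟩ := h.chainStep (i + 1)
    rw [hu.p0Minus, hj i rfl, smul_smul]
    congr 1
    push_cast
    ring
  refine ⟨key, fun hl i => ?_⟩
  induction i with
  | zero => exact fun _ => h.ne
  | succ i ih =>
    intro hi h0
    have hk := key i hi
    rw [h0, map_zero, eq_comm, smul_eq_zero] at hk
    refine hk.elim (fun hc => ?_) (ih (by omega))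
    have hz : ((i : ℤ) + 1) * (l + i - 1) * (m - 2 * i) * (m - 2 * i - 1) = 0 := by
      exact_mod_cast neg_eq_zero.mp hc
    simp only [mul_eq_zero] at hz
    omega

end
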